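/- Assume p⁻_{s⁻} > 0 for every s⁻ ∈ S⁻. The folding entropy of the zip shift, F(σ) := ∫_{x̂ ∈ σ⁻¹(ε)} H_{μ_{x̂}}(ε|_{x̂}) dμ̂(x̂) (where ε|_{x̂} = {{y} : y ∈ x̂} and μ_{x̂} is the disintegration of μ with respect to σ⁻¹(ε) given by μ_{x̂}({x̂(s)}) = p⁺_s/p⁻_{x_{−1}}), satisfies F(σ) = Σ_{s⁻∈S⁻} (Σ_{s⁺∈φ⁻¹(s⁻)} −q^{s⁻}_{s⁺} · log q^{s⁻}_{s⁺}) · p⁻_{s⁻} = H_μ(𝒞_0) − H_μ(𝒞_{−1}). -/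

import Mathlib

open MeasureTheory Filter Real

namespace ZipShiftPaper

variable {Sm Sp : Type*}

/-- `s` is an admissible symbol for index `i`: a negative symbol (inl) if `i < 0`,
a positive symbol (inr) if `i ≥ 0`. -/
def Adm (i : ℤ) (s : Sm ⊕ Sp) : Prop :=
  if i < 0 then s.isLeft = true else s.isRight = true

/-- The zip shift space: bilateral sequences with positive symbols on indices `≥ 0`
and negative symbols on indices `< 0`. -/
def ZipSpace (Sm Sp : Type*) := {x : ℤ → Sm ⊕ Sp // ∀ i, Adm i (x i)}

variable (φ : Sp → Sm)

/-- The transition function applied to a combined symbol. -/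
def phiHat : Sm ⊕ Sp → Sm ⊕ Sp
  | .inl t => .inl t
  | .inr s => .inl (φ s)

lemma adm_shift (x : ZipSpace Sm Sp) (i : ℤ) :
    Adm i (if i = -1 then phiHat φ (x.1 0) else x.1 (i + 1)) := by
  by_cases h : i = -1
  · subst h
    have h0 := x.2 0
    simp only [Adm, if_neg (by norm_num : ¬ (0:ℤ) < 0)] at h0
    simp only [if_pos rfl, Adm, if_pos (by norm_num : (-1:ℤ) < 0)]
    rcases hx : x.1 0 with t | s
    · rw [hx] at h0; simp at h0
    · simp [phiHat]
  · rw [if_neg h]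
    have h1 := x.2 (i + 1)
    unfold Adm at h1 ⊢
    by_cases hi : i < 0
    · rw [if_pos hi]; rw [if_pos (by omega)] at h1; exact h1
    · rw [if_neg hi]; rw [if_neg (by omega)] at h1; exact h1

/-- The zip shift map `σ_φ`. -/
def zipShift (x : ZipSpace Sm Sp) : ZipSpace Sm Sp :=
  ⟨fun i => if i = -1 then phiHat φ (x.1 0) else x.1 (i + 1), adm_shift φ x⟩

/-- The cylinder `C^s_i = {x : x_i = s}`. -/
def cyl (i : ℤ) (s : Sm ⊕ Sp) : Set (ZipSpace Sm Sp) := {x | x.1 i = s}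

/-- The σ-algebra on the zip shift space, generated by the cylinders. -/
instance zipMS : MeasurableSpace (ZipSpace Sm Sp) :=
  .generateFrom {C | ∃ i s, C = cyl i s}

/-- The partition `𝒞_i` of `Σ` by cylinders of index `i`. -/
def cylPart (i : ℤ) : Set (Set (ZipSpace Sm Sp)) :=
  {C | ∃ s : Sm ⊕ Sp, Adm i s ∧ C = cyl i s}

/-- Forward image of a partition: `f(P) = {f(A) : A ∈ P}`. -/
def pushPart {α : Type*} (f : α → α) (P : Set (Set α)) : Set (Set α) :=
  (Set.image f) '' P

/-- Pullback of a partition: `f⁻¹(P) = {f⁻¹(A) : A ∈ P}`. -/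
def pullPart {α : Type*} (f : α → α) (P : Set (Set α)) : Set (Set α) :=
  (Set.preimage f) '' P

/-- `σ^j(P)` for `j : ℤ`: forward image for `j ≥ 0`, preimage for `j < 0`. -/
def powPart {α : Type*} (f : α → α) (j : ℤ) (P : Set (Set α)) : Set (Set α) :=
  if 0 ≤ j then pushPart (f^[j.toNat]) P else pullPart (f^[(-j).toNat]) P

/-- Common refinement (correfinement) `⋁_{i ∈ t} P i` of a family of partitions:
all nonempty intersections of one element from each partition. -/
def corefine {α ι : Type*} (t : Set ι) (P : ι → Set (Set α)) : Set (Set α) :=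
  {A | A.Nonempty ∧ ∃ g : ι → Set α, (∀ i ∈ t, g i ∈ P i) ∧ A = ⋂ i ∈ t, g i}

/-- The partition `𝒞_{n,…,n'}` by cylinders of indices from `n` to `n'`. -/
def cylRange (n n' : ℤ) : Set (Set (ZipSpace Sm Sp)) :=
  corefine (Set.Icc n n') cylPart

/-- The `k`-th dynamical correfinement `⋁_{j=0}^{k-1} f^{-j}(P)`. -/
def dynRefine {α : Type*} (f : α → α) (P : Set (Set α)) (k : ℕ) : Set (Set α) :=
  corefine (Set.Iio k) (fun j : ℕ => pullPart (f^[j]) P)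

/-- Entropy of a partition: `H_μ(P) = Σ_{A ∈ P} -μ(A) log μ(A)`. -/
noncomputable def partH {α : Type*} [MeasurableSpace α] (μ : Measure α)
    (P : Set (Set α)) : ℝ :=
  ∑' A : P, Real.negMulLog ((μ (A : Set α)).toReal)

variable (pp : Sp → ℝ) [Fintype Sp] [DecidableEq Sm]

/-- The pushforward distribution `p⁻ = φ_* p⁺` on the negative symbols. -/
def pm (t : Sm) : ℝ := ∑ s ∈ Finset.univ.filter (fun s => φ s = t), pp s

/-- The weight of symbol `s` at coordinate `i`: `p⁺_s` for a positive symbol at `i ≥ 0`,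
`p⁻_s` for a negative symbol at `i < 0`, and `0` for inadmissible pairs. -/
def wt : ℤ → Sm ⊕ Sp → ℝ
  | i, .inl t => if i < 0 then pm φ pp t else 0
  | i, .inr s => if 0 ≤ i then pp s else 0

/-- `μ` is the product measure determined by `p⁺` (coordinates independent, coordinate `i`
distributed as `p⁺` for `i ≥ 0` and as `p⁻ = φ_* p⁺` for `i < 0`). -/
def IsProductMeasure (μ : Measure (ZipSpace Sm Sp)) : Prop :=
  ∀ (F : Finset ℤ) (c : ℤ → Sm ⊕ Sp),
    μ {x : ZipSpace Sm Sp | ∀ i ∈ F, x.1 i = c i}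
      = ∏ i ∈ F, ENNReal.ofReal (wt φ pp i (c i))

/-- The fiber space `σ⁻¹(ε) = {σ⁻¹({x}) : x ∈ Σ}`: the partition of `Σ` into
preimages of points, viewed as a type. -/
def Fib (φ : Sp → Sm) := {A : Set (ZipSpace Sm Sp) // ∃ x, A = zipShift φ ⁻¹' {x}}

/-- The natural projection `π : Σ → σ⁻¹(ε)`, `π(y) = σ⁻¹({σ(y)})`. -/
def fibProj (y : ZipSpace Sm Sp) : Fib φ :=
  ⟨zipShift φ ⁻¹' {zipShift φ y}, zipShift φ y, rfl⟩

/-- The quotient σ-algebra on `σ⁻¹(ε)`: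
`Q` is measurable iff `π⁻¹(Q)` is measurable in `Σ`. -/
instance fibMS : MeasurableSpace (Fib φ) :=
  MeasurableSpace.map (fibProj φ) (zipMS)

/-- `X̂ = {x̂ : x ∈ X}`, the set of fibers of points of `X`. -/
def hatSet (X : Set (ZipSpace Sm Sp)) : Set (Fib φ) :=
  {A | ∃ x ∈ X, A.1 = zipShift φ ⁻¹' {x}}

/-- The negative symbol `x_{-1}` of a point of the zip shift space. -/
def negSym (x : ZipSpace Sm Sp) : Sm :=
  (x.1 (-1)).getLeft (by
    have h := x.2 (-1)
    simpa [Adm, if_pos (by norm_num : (-1:ℤ) < 0)] using h)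

/-- The preimage `x̂(s) = (…, x_{-2}; s, x_0, x_1, …)` of `x` under the zip shift,
determined by the choice of positive symbol `s ∈ φ⁻¹(x_{-1})` at coordinate `0`. -/
def prePoint (x : ZipSpace Sm Sp) (s : Sp) : ZipSpace Sm Sp :=
  ⟨fun j => if j = 0 then .inr s else x.1 (j - 1), by
    intro j
    dsimp only
    by_cases h : j = 0
    · subst h
      simp [Adm]
    · rw [if_neg h]
      have h1 := x.2 (j - 1)
      unfold Adm at h1 ⊢
      by_cases hj : j < 0
      · rw [if_pos hj]; rw [if_pos (by omega)] at h1; exact h1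
      · rw [if_neg hj]; rw [if_neg (by omega)] at h1; exact h1⟩

/-- The conditional measure `μ_{x̂}` on the fiber `x̂ = σ⁻¹({x})`, giving mass
`q^{x_{-1}}_s = p⁺_s / p⁻_{x_{-1}}` to the point `x̂(s)`, `s ∈ φ⁻¹(x_{-1})`. -/
noncomputable def condMeas (x : ZipSpace Sm Sp) : Measure (ZipSpace Sm Sp) :=
  ∑ s ∈ Finset.univ.filter (fun s => φ s = negSym x),
    (ENNReal.ofReal (pp s / pm φ pp (negSym x))) • Measure.dirac (prePoint x s)

/-- The conditional measure attached to a fiber `A ∈ σ⁻¹(ε)`. -/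
noncomputable def condMeasFib (A : Fib φ) : Measure (ZipSpace Sm Sp) :=
  condMeas φ pp A.2.choose

/-- The entropy `H_{μ_{x̂}}(ε|_{x̂})` of the restriction of the atomic partition to the
fiber `x̂`, with respect to the conditional measure `μ_{x̂}`. -/
noncomputable def fibH (A : Fib φ) : ℝ :=
  ∑' y : A.1,
    Real.negMulLog ((condMeasFib φ pp A {(y : ZipSpace Sm Sp)}).toReal)

/-- The folding entropy `F(σ) = ∫ H_{μ_{x̂}}(ε|_{x̂}) dμ̂(x̂)`, where `μ̂ = π_* μ` is the
quotient measure on `σ⁻¹(ε)`. -/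
noncomputable def foldH (μ : Measure (ZipSpace Sm Sp)) : ℝ :=
  ∫ A, fibH φ pp A ∂(μ.map (fibProj φ))

/-- A finite measurable partition (mod 0) of a probability space. -/
def IsFinPart {α : Type*} [MeasurableSpace α] (μ : Measure α) (P : Set (Set α)) : Prop :=
  P.Finite ∧ (∀ A ∈ P, MeasurableSet A) ∧ P.Pairwise Disjoint ∧ μ (⋃₀ P) = 1


/-- The Kolmogorov–Sinai entropy: the supremum, over all finite measurable partitions `P`,
of the limits `h_μ(f, P) = lim_n H_μ(⋁_{j=0}^{n-1} f^{-j}P)/n`. -/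
noncomputable def ksEntropy {α : Type*} [MeasurableSpace α] (μ : Measure α) (f : α → α) : ℝ :=
  sSup {h : ℝ | ∃ P : Set (Set α), IsFinPart μ P ∧
    Tendsto (fun n : ℕ => partH μ (dynRefine f P n) / n) atTop (nhds h)}


end ZipShiftPaper

open ZipShiftPaper

namespace ZipShiftPaper

section Space

variable {Sm Sp : Type*}

/-- The positive symbol `x_0` of a point of the zip shift space. -/
def posSym (x : ZipSpace Sm Sp) : Sp :=
  (x.1 0).getRight (by simpa [Adm] using x.2 0)

lemma coord_zero (x : ZipSpace Sm Sp) : x.1 0 = .inr (posSym x) :=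
  (Sum.inr_getRight _ _).symm

lemma coord_neg_one (x : ZipSpace Sm Sp) : x.1 (-1) = .inl (negSym x) :=
  (Sum.inl_getLeft _ _).symm

lemma measurableSet_cyl (i : ℤ) (s : Sm ⊕ Sp) : MeasurableSet (cyl i s) :=
  MeasurableSpace.measurableSet_generateFrom ⟨i, s, rfl⟩

instance : MeasurableSingletonClass (ZipSpace Sm Sp) where
  measurableSet_singleton y := by
    have h : ({y} : Set (ZipSpace Sm Sp)) = ⋂ i : ℤ, cyl i (y.1 i) := by
      ext x
      simp only [Set.mem_singleton_iff, Set.mem_iInter, cyl, Set.mem_ofPred_eq]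
      exact ⟨fun h i => by rw [h], fun h => Subtype.ext (funext h)⟩
    rw [h]
    exact MeasurableSet.iInter fun i => measurableSet_cyl i _

lemma posSym_preimage_singleton (s : Sp) :
    (posSym (Sm := Sm)) ⁻¹' {s} = cyl 0 (.inr s) := by
  ext x
  simp [cyl, coord_zero]

lemma cyl_nonempty [Nonempty Sm] [Nonempty Sp] {i : ℤ} {s : Sm ⊕ Sp} (h : Adm i s) :
    (cyl i s).Nonempty := by
  obtain ⟨a⟩ := ‹Nonempty Sm›
  obtain ⟨b⟩ := ‹Nonempty Sp›
  refine ⟨⟨fun j => if j = i then s else if j < 0 then .inl a else .inr b, fun j => ?_⟩, ?_⟩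
  · dsimp only
    split_ifs with h1 h2
    · rwa [h1]
    · simp [Adm, h2]
    · simp [Adm, h2]
  · exact if_pos rfl

lemma cyl_eq_cyl [Nonempty Sm] [Nonempty Sp] {i : ℤ} {s t : Sm ⊕ Sp} (hs : Adm i s)
    (h : cyl i s = cyl i t) : s = t := by
  obtain ⟨x, hx⟩ := cyl_nonempty hs
  have hx' : x ∈ cyl i t := h ▸ hx
  exact hx.symm.trans hx'

lemma partH_cylPart [Nonempty Sm] [Nonempty Sp] {ι : Type*} [Fintype ι]
    (μ : Measure (ZipSpace Sm Sp)) (i : ℤ) (e : ι → Sm ⊕ Sp) (he : Function.Injective e)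
    (hrange : ∀ s, Adm i s ↔ s ∈ Set.range e) :
    partH μ (cylPart i) = ∑ a, negMulLog (μ (cyl i (e a))).toReal := by
  have hadm (a : ι) : Adm i (e a) := (hrange _).2 ⟨a, rfl⟩
  let f : ι → cylPart (Sm := Sm) (Sp := Sp) i := fun a => ⟨cyl i (e a), e a, hadm a, rfl⟩
  have hf : Function.Bijective f := by
    constructor
    · intro a b hab
      exact he (cyl_eq_cyl (hadm a) (congrArg Subtype.val hab))
    · rintro ⟨C, s, hs, rfl⟩
      obtain ⟨a, rfl⟩ := (hrange s).1 hs
      exact ⟨a, rfl⟩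
  rw [partH, ← (Equiv.ofBijective f hf).tsum_eq, tsum_fintype]
  rfl

lemma prePoint_injective (x : ZipSpace Sm Sp) : Function.Injective (prePoint x) := by
  intro s t h
  have h0 := congrFun (congrArg Subtype.val h) 0
  simpa [prePoint] using h0

variable (φ : Sp → Sm)

lemma negSym_zipShift (y : ZipSpace Sm Sp) : negSym (zipShift φ y) = φ (posSym y) := by
  have h : (zipShift φ y).1 (-1) = .inl (φ (posSym y)) := by
    simp [zipShift, coord_zero, phiHat]
  exact Sum.inl_injective ((coord_neg_one _).symm.trans h)

lemma zipShift_prePoint {x : ZipSpace Sm Sp} {s : Sp} (h : φ s = negSym x) :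
    zipShift φ (prePoint x s) = x := by
  refine Subtype.ext (funext fun i => ?_)
  by_cases hi : i = -1
  · subst hi
    simp [zipShift, prePoint, phiHat, h, coord_neg_one]
  · have h1 : i + 1 ≠ 0 := by omega
    simp [zipShift, prePoint, hi, h1]

lemma prePoint_zipShift (y : ZipSpace Sm Sp) : prePoint (zipShift φ y) (posSym y) = y := by
  refine Subtype.ext (funext fun i => ?_)
  by_cases hi : i = 0
  · subst hi
    simp [prePoint, coord_zero]
  · simp [zipShift, prePoint, hi]

/-- The points of the fiber `x̂` are the `x̂(s)` with `s ∈ φ⁻¹(x_{-1})`. -/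
lemma prePoint_bijective (x : ZipSpace Sm Sp) :
    Function.Bijective (fun s : {s : Sp // φ s = negSym x} =>
      (⟨prePoint x s, zipShift_prePoint φ s.2⟩ : zipShift φ ⁻¹' {x})) := by
  constructor
  · intro s t h
    exact Subtype.ext (prePoint_injective x (congrArg Subtype.val h))
  · rintro ⟨y, rfl⟩
    exact ⟨⟨posSym y, (negSym_zipShift φ y).symm⟩, Subtype.ext (prePoint_zipShift φ y)⟩

lemma measurable_fibProj : Measurable (fibProj φ) := fun _ h => h

end Space

section Entropy

variable {Sm Sp : Type*} [Fintype Sp] [DecidableEq Sm] (φ : Sp → Sm) (pp : Sp → ℝ)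

lemma pm_nonneg {pp : Sp → ℝ} (hpp : ∀ s, 0 ≤ pp s) (t : Sm) : 0 ≤ pm φ pp t :=
  Finset.sum_nonneg fun s _ => hpp s

lemma condMeas_singleton_prePoint {pp : Sp → ℝ} (hpp : ∀ s, 0 ≤ pp s) {x : ZipSpace Sm Sp}
    {s : Sp} (hs : φ s = negSym x) :
    (condMeas φ pp x {prePoint x s}).toReal = pp s / pm φ pp (negSym x) := by
  have h : condMeas φ pp x {prePoint x s} = ENNReal.ofReal (pp s / pm φ pp (negSym x)) := by
    rw [condMeas, Measure.finsetSum_apply, Finset.sum_eq_single s]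
    · simp
    · intro t _ hts
      have hne : prePoint x t ≠ prePoint x s := fun h => hts (prePoint_injective x h)
      simp [hne]
    · simp [hs]
  rw [h, ENNReal.toReal_ofReal (div_nonneg (hpp s) (pm_nonneg φ hpp _))]

/-- The entropy of the distribution `q^t` on `φ⁻¹(t)`. -/
noncomputable def symFibH (t : Sm) : ℝ :=
  ∑ s ∈ Finset.univ.filter (fun s => φ s = t), negMulLog (pp s / pm φ pp t)

lemma tsum_condMeas {pp : Sp → ℝ} (hpp : ∀ s, 0 ≤ pp s) (x : ZipSpace Sm Sp) :
    ∑' y : zipShift φ ⁻¹' {x}, negMulLog (condMeas φ pp x {(y : ZipSpace Sm Sp)}).toReal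
      = symFibH φ pp (negSym x) := by
  rw [← (Equiv.ofBijective _ (prePoint_bijective φ x)).tsum_eq, tsum_fintype, symFibH,
    Finset.sum_subtype (p := fun s => φ s = negSym x) _ (by simp)]
  refine Finset.sum_congr rfl fun s _ => ?_
  rw [← condMeas_singleton_prePoint φ hpp s.2]
  rfl

lemma fibH_fibProj {pp : Sp → ℝ} (hpp : ∀ s, 0 ≤ pp s) (y : ZipSpace Sm Sp) :
    fibH φ pp (fibProj φ y) = symFibH φ pp (φ (posSym y)) := by
  obtain ⟨A, hA⟩ : ∃ A, A = fibProj φ y := ⟨_, rfl⟩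
  have hspec : A.1 = zipShift φ ⁻¹' {A.2.choose} := A.2.choose_spec
  have hy : y ∈ A.1 := by
    rw [hA]
    exact rfl
  have hx : zipShift φ y = A.2.choose := by
    rw [hspec] at hy
    exact hy
  rw [← hA, fibH, condMeasFib, ← hx, hspec, ← hx, tsum_condMeas φ hpp, negSym_zipShift]

lemma foldH_eq_sum {pp : Sp → ℝ} (hpp : ∀ s, 0 ≤ pp s) (μ : Measure (ZipSpace Sm Sp))
    [IsFiniteMeasure μ] :
    foldH φ pp μ = ∑ s, (μ (cyl 0 (.inr s))).toReal * symFibH φ pp (φ s) := by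
  let _ : MeasurableSpace Sp := ⊤
  have hpos : Measurable (posSym : ZipSpace Sm Sp → Sp) :=
    measurable_to_countable' fun s => by
      rw [posSym_preimage_singleton]
      exact measurableSet_cyl _ _
  have hcomp : fibH φ pp ∘ fibProj φ = (fun s => symFibH φ pp (φ s)) ∘ posSym :=
    funext (fibH_fibProj φ hpp)
  have hfib : Measurable (fibH φ pp) := by
    intro B hB
    change MeasurableSet (fibProj φ ⁻¹' (fibH φ pp ⁻¹' B))
    rw [← Set.preimage_comp, hcomp]
    exact (measurable_from_top.comp hpos) hB
  rw [foldH, integral_map (measurable_fibProj φ).aemeasurable hfib.aestronglyMeasurable]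
  simp only [fibH_fibProj φ hpp]
  rw [← integral_map (f := fun s => symFibH φ pp (φ s)) hpos.aemeasurable
    measurable_from_top.aestronglyMeasurable, integral_fintype (.of_finite)]
  refine Finset.sum_congr rfl fun s _ => ?_
  rw [smul_eq_mul, measureReal_def, Measure.map_apply hpos (measurableSet_singleton s),
    posSym_preimage_singleton]

lemma IsProductMeasure.measure_cyl {φ : Sp → Sm} {pp : Sp → ℝ} {μ : Measure (ZipSpace Sm Sp)}
    (hμ : IsProductMeasure φ pp μ) (i : ℤ) (s : Sm ⊕ Sp) :
    μ (cyl i s) = ENNReal.ofReal (wt φ pp i s) := by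
  simpa [cyl] using hμ {i} fun _ => s

lemma IsProductMeasure.isProbabilityMeasure {φ : Sp → Sm} {pp : Sp → ℝ}
    {μ : Measure (ZipSpace Sm Sp)} (hμ : IsProductMeasure φ pp μ) (c : Sm ⊕ Sp) :
    IsProbabilityMeasure μ :=
  ⟨by simpa using hμ ∅ fun _ => c⟩

lemma symFibH_mul_pm {t : Sm} (ht : pm φ pp t ≠ 0) :
    symFibH φ pp t * pm φ pp t
      = ∑ s ∈ Finset.univ.filter (fun s => φ s = t), negMulLog (pp s)
        - negMulLog (pm φ pp t) := by
  have h (s : Sp) : negMulLog (pp s / pm φ pp t) * pm φ pp t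
      = negMulLog (pp s) + pp s * log (pm φ pp t) := by
    rcases eq_or_ne (pp s) 0 with hs | hs
    · simp [hs]
    · rw [negMulLog, negMulLog, log_div hs ht]
      field_simp
      ring
  rw [symFibH, Finset.sum_mul, Finset.sum_congr rfl fun s _ => h s, Finset.sum_add_distrib,
    ← Finset.sum_mul, negMulLog]
  change _ + pm φ pp t * _ = _
  ring

end Entropy

end ZipShiftPaper

/-- the folding entropy formula
`F(σ) = Σ_{s⁻} (Σ_{s⁺ ∈ φ⁻¹ s⁻} -q log q) p⁻_{s⁻} = H_μ(𝒞_0) - H_μ(𝒞_{-1})`. -/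
theorem statement15 {Sm Sp : Type*} [Fintype Sm] [Fintype Sp] [Nonempty Sm] [Nonempty Sp]
    [DecidableEq Sm]
    (φ : Sp → Sm) (hφ : Function.Surjective φ)
    (pp : Sp → ℝ) (hpp : ∀ s, 0 ≤ pp s) (hsum : ∑ s, pp s = 1)
    (hpm : ∀ t : Sm, 0 < pm φ pp t)
    (μ : Measure (ZipSpace Sm Sp)) (hμ : IsProductMeasure φ pp μ) :
    foldH φ pp μ
      = ∑ t : Sm, (∑ s ∈ Finset.univ.filter (fun s => φ s = t),
          -(pp s / pm φ pp t) * Real.log (pp s / pm φ pp t)) * pm φ pp t ∧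
    foldH φ pp μ = partH μ (cylPart 0) - partH μ (cylPart (-1)) := by
  have : IsProbabilityMeasure μ := hμ.isProbabilityMeasure (.inl (Classical.arbitrary Sm))
  have hfold : foldH φ pp μ = ∑ t : Sm, symFibH φ pp t * pm φ pp t := by
    rw [foldH_eq_sum φ hpp, ← Finset.sum_fiberwise Finset.univ φ]
    refine Finset.sum_congr rfl fun t _ => ?_
    rw [pm, Finset.mul_sum]
    refine Finset.sum_congr rfl fun s hs => ?_
    rw [hμ.measure_cyl, (Finset.mem_filter.1 hs).2, mul_comm]
    simp [wt, ENNReal.toReal_ofReal (hpp s)]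
  have hzero : partH μ (cylPart 0) = ∑ s, negMulLog (pp s) := by
    rw [partH_cylPart μ 0 Sum.inr Sum.inr_injective (by simp [Adm])]
    refine Finset.sum_congr rfl fun s _ => ?_
    simp [hμ.measure_cyl, wt, ENNReal.toReal_ofReal (hpp s)]
  have hneg : partH μ (cylPart (-1)) = ∑ t, negMulLog (pm φ pp t) := by
    rw [partH_cylPart μ (-1) Sum.inl Sum.inl_injective (by simp [Adm])]
    refine Finset.sum_congr rfl fun t _ => ?_
    simp [hμ.measure_cyl, wt, ENNReal.toReal_ofReal (hpm t).le]
  refine ⟨hfold, ?_⟩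
  rw [hfold, hzero, hneg, ← Finset.sum_fiberwise Finset.univ φ, ← Finset.sum_sub_distrib]
  exact Finset.sum_congr rfl fun t _ => symFibH_mul_pm φ pp (hpm t).ne'
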